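/- Let f(x; w) = W_L ⋯ W_1 x be a deep linear network of depth L with single output (d_L = 1), with each W_l nonzero and output scale F(w) = √d₀·∏_{l=1}^L ‖W_l‖_*. Let x₁,…,x_m ∈ ℝ^{d₀} satisfy ‖xᵢ‖₂ = √d₀, let Y ∈ ℝᵐ, and let L₂(w) = (1/(2m))·‖f_X(w) − Y‖₂² be the square loss. Let η > 0 and let Δw = (ΔW_1,…,ΔW_L) satisfy ‖ΔW_l‖_* = (η/L)·‖W_l‖_* for every l. Then: L₂(w+Δw) − [L₂(w) + ⟨∇_w L₂(w), Δw⟩] ≤ (1/2)·F(w)·(F(w) + ‖Y‖₂/√m)·(e^{2η} − 2η − 1). -/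

import Mathlib

/-- The spectral norm (largest singular value) of a real matrix, as the operator norm of
the induced linear map between Euclidean spaces. -/
noncomputable def specNorm {p q : ℕ} (A : Matrix (Fin p) (Fin q) ℝ) : ℝ :=
  ‖LinearMap.toContinuousLinearMap (Matrix.toEuclideanLin A)‖

/-- A deep linear network: `netFwd d W L x = W_{L} ⋯ W_1 x` where the `l`-th weight matrix
(0-indexed) `W l` has dimensions `d (l+1) × d l`. -/
def netFwd (d : ℕ → ℕ) (W : ∀ l : ℕ, Matrix (Fin (d (l + 1))) (Fin (d l)) ℝ) :
    (L : ℕ) → (Fin (d 0) → ℝ) → Fin (d L) → ℝ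
  | 0, x => x
  | L + 1, x => (W L).mulVec (netFwd d W L x)

/-- The Euclidean norm of a vector in `ℝⁿ`. -/
noncomputable def euclNorm {n : ℕ} (v : Fin n → ℝ) : ℝ :=
  Real.sqrt (∑ i, (v i) ^ 2)

lemma euclNorm_eq {n : ℕ} (v : Fin n → ℝ) : euclNorm v = ‖(WithLp.toLp 2 v : EuclideanSpace ℝ (Fin n))‖ := by
  simp [euclNorm, EuclideanSpace.norm_eq]

lemma euclNorm_nn {n : ℕ} (v : Fin n → ℝ) : 0 ≤ euclNorm v := Real.sqrt_nonneg _

lemma specNorm_nn {p q : ℕ} (A : Matrix (Fin p) (Fin q) ℝ) : 0 ≤ specNorm A := norm_nonneg _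

lemma euclNorm_add_le {n : ℕ} (v w : Fin n → ℝ) : euclNorm (v + w) ≤ euclNorm v + euclNorm w := by
  simp only [euclNorm_eq, WithLp.toLp_add]
  exact norm_add_le _ _

lemma euclNorm_mulVec_le {p q : ℕ} (A : Matrix (Fin p) (Fin q) ℝ) (v : Fin q → ℝ) :
    euclNorm (A.mulVec v) ≤ specNorm A * euclNorm v := by
  have h := (LinearMap.toContinuousLinearMap (Matrix.toEuclideanLin A)).le_opNorm (WithLp.toLp 2 v)
  simpa [euclNorm_eq, specNorm] using h

lemma abs_sum_le_euclNorm {n : ℕ} (hn : n = 1) (v : Fin n → ℝ) : |∑ j, v j| ≤ euclNorm v := by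
  subst hn
  simp [euclNorm, Real.sqrt_sq_eq_abs]

/-- First-order term of the network perturbation. -/
def netB (d : ℕ → ℕ) (W V : ∀ l : ℕ, Matrix (Fin (d (l + 1))) (Fin (d l)) ℝ) (x : Fin (d 0) → ℝ) :
    (L : ℕ) → Fin (d L) → ℝ
  | 0 => 0
  | L + 1 => (W L).mulVec (netB d W V x L) + (V L).mulVec (netFwd d W L x)

/-- Higher-order remainder of the network perturbation. -/
def netR (d : ℕ → ℕ) (W V : ∀ l : ℕ, Matrix (Fin (d (l + 1))) (Fin (d l)) ℝ) (x : Fin (d 0) → ℝ) :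
    (L : ℕ) → Fin (d L) → ℝ
  | 0 => 0
  | L + 1 => ((W L).mulVec (netR d W V x L) + (V L).mulVec (netR d W V x L))
      + (V L).mulVec (netB d W V x L)

lemma net_split (d : ℕ → ℕ) (W V : ∀ l : ℕ, Matrix (Fin (d (l + 1))) (Fin (d l)) ℝ)
    (x : Fin (d 0) → ℝ) (k : ℕ) :
    netFwd d (fun l => W l + V l) k x = netFwd d W k x + netB d W V x k + netR d W V x k := by
  induction k with
  | zero => simp [netFwd, netB, netR]
  | succ k ih =>
    simp only [netFwd, netB, netR, ih, Matrix.mulVec_add, Matrix.add_mulVec]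
    abel

lemma net_deriv (d : ℕ → ℕ) (W V : ∀ l : ℕ, Matrix (Fin (d (l + 1))) (Fin (d l)) ℝ)
    (x : Fin (d 0) → ℝ) (k : ℕ) (j : Fin (d k)) :
    HasDerivAt (fun t : ℝ => netFwd d (fun l => W l + t • V l) k x j) (netB d W V x k j) 0 := by
  induction k with
  | zero => simpa [netFwd, netB] using hasDerivAt_const (0 : ℝ) (x j)
  | succ k ih =>
    have h : HasDerivAt (fun t : ℝ => ∑ i, (W k j i + t * V k j i) *
        netFwd d (fun l => W l + t • V l) k x i)
        (∑ i, ((V k j i) * netFwd d (fun l => W l + (0:ℝ) • V l) k x i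
          + (W k j i + 0 * V k j i) * netB d W V x k i)) 0 := by
      refine HasDerivAt.fun_sum fun i _ => ?_
      refine HasDerivAt.mul ?_ (ih i)
      simpa using ((hasDerivAt_id (0:ℝ)).mul_const (V k j i)).const_add (W k j i)
    convert h using 1
    all_goals simp [netB, netFwd, Matrix.mulVec, dotProduct, Finset.sum_add_distrib, add_comm]

lemma net_bounds (d : ℕ → ℕ) (W V : ∀ l : ℕ, Matrix (Fin (d (l + 1))) (Fin (d l)) ℝ)
    (x : Fin (d 0) → ℝ) (c : ℝ) (hc : 0 ≤ c) (k : ℕ)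
    (h : ∀ l < k, specNorm (V l) = c * specNorm (W l)) :
    euclNorm (netFwd d W k x) ≤ euclNorm x * ∏ l ∈ Finset.range k, specNorm (W l) ∧
    euclNorm (netB d W V x k) ≤ (k * c) * (euclNorm x * ∏ l ∈ Finset.range k, specNorm (W l)) ∧
    euclNorm (netR d W V x k) ≤
      ((1 + c) ^ k - 1 - k * c) * (euclNorm x * ∏ l ∈ Finset.range k, specNorm (W l)) := by
  induction k with
  | zero => simp [netFwd, netB, netR, euclNorm]
  | succ k ih =>
    obtain ⟨h1, h2, h3⟩ := ih fun l hl => h l (by omega)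
    have hk := h k (by omega)
    have hs := specNorm_nn (W k)
    have hcs : 0 ≤ c * specNorm (W k) := mul_nonneg hc hs
    rw [Finset.prod_range_succ]
    set F := euclNorm x * ∏ l ∈ Finset.range k, specNorm (W l) with hF
    have e : euclNorm x * ((∏ l ∈ Finset.range k, specNorm (W l)) * specNorm (W k))
        = F * specNorm (W k) := by rw [hF]; ring
    rw [e]
    refine ⟨?_, ?_, ?_⟩
    · have := euclNorm_mulVec_le (W k) (netFwd d W k x)
      have := mul_le_mul_of_nonneg_left h1 hs
      simp only [netFwd]
      linarith
    · have a1 := euclNorm_mulVec_le (W k) (netB d W V x k)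
      have a2 := euclNorm_mulVec_le (V k) (netFwd d W k x)
      have a3 := mul_le_mul_of_nonneg_left h2 hs
      have a4 := mul_le_mul_of_nonneg_left h1 hcs
      have a5 := euclNorm_add_le ((W k).mulVec (netB d W V x k)) ((V k).mulVec (netFwd d W k x))
      rw [hk] at a2
      simp only [netB]
      push_cast
      linarith
    · have a1 := euclNorm_mulVec_le (W k) (netR d W V x k)
      have a2 := euclNorm_mulVec_le (V k) (netR d W V x k)
      have a3 := euclNorm_mulVec_le (V k) (netB d W V x k)
      have a4 := mul_le_mul_of_nonneg_left h3 hs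
      have a5 := mul_le_mul_of_nonneg_left h3 hcs
      have a6 := mul_le_mul_of_nonneg_left h2 hcs
      have a7 := euclNorm_add_le ((W k).mulVec (netR d W V x k) + (V k).mulVec (netR d W V x k))
        ((V k).mulVec (netB d W V x k))
      have a8 := euclNorm_add_le ((W k).mulVec (netR d W V x k)) ((V k).mulVec (netR d W V x k))
      rw [hk] at a2 a3
      simp only [netR]
      push_cast
      rw [pow_succ]
      linarith

lemma scalar_bound (p q r F η R : ℝ) (hη : 0 ≤ η) (hR : 0 ≤ R) (hF : 0 ≤ F) (hp : |p| ≤ F)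
    (hq : |q| ≤ η * F) (hr : |r| ≤ R * F) :
    (p + q + r) ^ 2 - p ^ 2 - 2 * p * q ≤ F ^ 2 * ((1 + η + R) ^ 2 - 1 - 2 * η) := by
  have b1 : q * q ≤ (η * F) * (η * F) :=
    (le_abs_self _).trans (by rw [abs_mul]; gcongr)
  have b2 : r * r ≤ (R * F) * (R * F) :=
    (le_abs_self _).trans (by rw [abs_mul]; gcongr)
  have b3 : p * r ≤ F * (R * F) :=
    (le_abs_self _).trans (by rw [abs_mul]; gcongr)
  have b4 : q * r ≤ (η * F) * (R * F) :=
    (le_abs_self _).trans (by rw [abs_mul]; gcongr)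
  linarith

/-- Majorisation of the square loss for a single-output deep linear
network under equal layerwise updates `‖ΔWₗ‖_* = (η/L)·‖Wₗ‖_*`: writing `D` for the
derivative of the loss at `w` in the direction `Δw` (the directional derivative
`⟨∇_w L₂(w), Δw⟩`), one has
`L₂(w+Δw) − [L₂(w) + D] ≤ (1/2)·F(w)·(F(w) + ‖Y‖₂/√m)·(e^{2η} − 2η − 1)`. -/
theorem deep_linear_network_square_loss_majorisation (L : ℕ) (d : ℕ → ℕ) (hdL : d L = 1)
    (W ΔW : ∀ l : ℕ, Matrix (Fin (d (l + 1))) (Fin (d l)) ℝ)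
    (hW : ∀ l < L, W l ≠ 0)
    (m : ℕ) (x : Fin m → Fin (d 0) → ℝ)
    (hx : ∀ i, euclNorm (x i) = Real.sqrt (d 0))
    (Y : Fin m → ℝ)
    (loss : (∀ l : ℕ, Matrix (Fin (d (l + 1))) (Fin (d l)) ℝ) → ℝ)
    (hloss : ∀ V, loss V =
      (1 / (2 * (m : ℝ))) * ∑ i, ((∑ j, netFwd d V L (x i) j) - Y i) ^ 2)
    (η : ℝ) (hη : 0 < η)
    (hansatz : ∀ l < L, specNorm (ΔW l) = (η / (L : ℝ)) * specNorm (W l))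
    (D : ℝ)
    (hD : HasDerivAt (fun t : ℝ => loss (fun l => W l + t • ΔW l)) D 0) :
    loss (fun l => W l + ΔW l) - (loss W + D)
      ≤ (1 / 2) * (Real.sqrt (d 0) * ∏ l ∈ Finset.range L, specNorm (W l)) *
          ((Real.sqrt (d 0) * ∏ l ∈ Finset.range L, specNorm (W l))
            + euclNorm Y / Real.sqrt m) *
          (Real.exp (2 * η) - 2 * η - 1) := by
  set F := Real.sqrt (d 0) * ∏ l ∈ Finset.range L, specNorm (W l) with hFdef
  have hF : 0 ≤ F := mul_nonneg (Real.sqrt_nonneg _) (Finset.prod_nonneg fun l _ => specNorm_nn _)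
  set R := Real.exp η - 1 - η with hRdef
  have hR : 0 ≤ R := by have := Real.add_one_le_exp η; linarith
  have hexp : Real.exp (2 * η) = (1 + η + R) ^ 2 := by
    rw [hRdef, show 1 + η + (Real.exp η - 1 - η) = Real.exp η by ring, two_mul, Real.exp_add, sq]
  let p : Fin m → ℝ := fun i => ∑ j, netFwd d W L (x i) j
  let q : Fin m → ℝ := fun i => ∑ j, netB d W ΔW (x i) L j
  let r : Fin m → ℝ := fun i => ∑ j, netR d W ΔW (x i) L j
  have hc : 0 ≤ η / (L : ℝ) := by positivity
  have hb := fun i => net_bounds d W ΔW (x i) (η / L) hc L hansatz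
  simp only [hx, ← hFdef] at hb
  have hLc : (L : ℝ) * (η / L) ≤ η := by
    rcases Nat.eq_zero_or_pos L with h | h
    · simp [h, hη.le]
    · have : (L : ℝ) ≠ 0 := by positivity
      exact (mul_div_cancel₀ η this).le
  have hLR : (1 + η / L) ^ L - 1 - L * (η / L) ≤ R := by
    rcases Nat.eq_zero_or_pos L with h | h
    · subst h; simpa using hR
    · have h0 : (L : ℝ) ≠ 0 := by positivity
      have : (1 + η / L) ^ L ≤ Real.exp η := by
        calc (1 + η / L) ^ L ≤ (Real.exp (η / L)) ^ L := by
              gcongr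
              linarith [Real.add_one_le_exp (η / L)]
          _ = Real.exp η := by rw [← Real.exp_nat_mul, mul_div_cancel₀ η h0]
      rw [mul_div_cancel₀ η h0]
      linarith
  have hp : ∀ i, |p i| ≤ F := fun i => (abs_sum_le_euclNorm hdL _).trans (hb i).1
  have hq : ∀ i, |q i| ≤ η * F := fun i =>
    (abs_sum_le_euclNorm hdL _).trans ((hb i).2.1.trans (by gcongr))
  have hr : ∀ i, |r i| ≤ R * F := fun i =>
    (abs_sum_le_euclNorm hdL _).trans ((hb i).2.2.trans (by gcongr))
  have hDeq : D = (1 / (2 * (m : ℝ))) * ∑ i, 2 * (p i - Y i) * q i := by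
    refine hD.unique ?_
    simp only [hloss]
    refine HasDerivAt.const_mul _ (HasDerivAt.fun_sum fun i _ => ?_)
    have h1 : HasDerivAt (fun t : ℝ => (∑ j, netFwd d (fun l => W l + t • ΔW l) L (x i) j) - Y i)
        (q i) 0 :=
      (HasDerivAt.fun_sum fun j _ => net_deriv d W ΔW (x i) L j).sub_const _
    simpa [p] using h1.fun_pow 2
  have hnew : ∀ i, ∑ j, netFwd d (fun l => W l + ΔW l) L (x i) j = p i + q i + r i := by
    intro i
    simp [net_split, p, q, r, Finset.sum_add_distrib]
  rw [hloss, hloss, hDeq]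
  simp only [hnew]
  change _ * _ - (_ * ∑ i, (p i - Y i) ^ 2 + _) ≤ _
  have hY : ∀ i, |Y i| * |r i| ≤ |Y i| * (R * F) := fun i => by have := hr i; gcongr
  have hsum : ∑ i, (p i + q i + r i - Y i) ^ 2 - (∑ i, (p i - Y i) ^ 2 + ∑ i, 2 * (p i - Y i) * q i)
      ≤ m * (F ^ 2 * ((1 + η + R) ^ 2 - 1 - 2 * η)) + 2 * (R * F) * ∑ i, |Y i| := by
    rw [← Finset.sum_add_distrib, ← Finset.sum_sub_distrib, Finset.mul_sum]
    have : (m : ℝ) * (F ^ 2 * ((1 + η + R) ^ 2 - 1 - 2 * η))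
      = ∑ i : Fin m, (F ^ 2 * ((1 + η + R) ^ 2 - 1 - 2 * η)) := by simp
    rw [this, ← Finset.sum_add_distrib]
    refine Finset.sum_le_sum fun i _ => ?_
    have h1 := scalar_bound _ _ _ F η R hη.le hR hF (hp i) (hq i) (hr i)
    have h2 := neg_abs_le (Y i * r i)
    rw [abs_mul] at h2
    linarith [hY i]
  have hCS : ∑ i, |Y i| ≤ Real.sqrt m * euclNorm Y := by
    rw [euclNorm, ← Real.sqrt_mul (Nat.cast_nonneg m)]
    apply Real.le_sqrt_of_sq_le
    have := sq_sum_le_card_mul_sum_sq (s := Finset.univ) (f := fun i => |Y i|)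
    simpa using this
  have hYn := euclNorm_nn Y
  rw [← mul_add, ← mul_sub]
  rcases Nat.eq_zero_or_pos m with h | hm
  · subst h
    have : 0 ≤ Real.exp (2 * η) - 2 * η - 1 := by
      have := Real.add_one_le_exp (2 * η); linarith
    simp only [Nat.cast_zero, mul_zero, div_zero, zero_mul, Real.sqrt_zero, add_zero]
    positivity
  have hm' : (0 : ℝ) < m := by exact_mod_cast hm
  have hs : 0 < Real.sqrt m := Real.sqrt_pos.2 hm'
  have hss : Real.sqrt m * Real.sqrt m = m := Real.mul_self_sqrt hm'.le
  have hdiv : euclNorm Y / Real.sqrt m = Real.sqrt m * euclNorm Y / m := by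
    rw [div_eq_div_iff hs.ne' hm'.ne']
    linear_combination (-euclNorm Y) * hss
  rw [hexp, hdiv]
  set E := Real.sqrt m * euclNorm Y with hE
  have hE0 : 0 ≤ E := by positivity
  have key : 2 * (R * F) * ∑ i, |Y i| ≤ ((1 + η + R) ^ 2 - 1 - 2 * η) * F * E := by
    have h1 : 2 * R ≤ (1 + η + R) ^ 2 - 1 - 2 * η := by nlinarith [mul_nonneg hη.le hR]
    calc 2 * (R * F) * ∑ i, |Y i| ≤ 2 * (R * F) * E := by gcongr
      _ = (2 * R) * F * E := by ring
      _ ≤ _ := by gcongr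
  calc _ ≤ 1 / (2 * (m : ℝ)) * (m * (F ^ 2 * ((1 + η + R) ^ 2 - 1 - 2 * η))
        + ((1 + η + R) ^ 2 - 1 - 2 * η) * F * E) := by
        gcongr
        linarith
    _ = _ := by field_simp; ring
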